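/- Let Γ ⊂ ℝ² be a simple union of C¹ curve segments. There exists N ∈ ℕ such that for every n ≥ N and every k ∈ ℤ² with ℋ¹(□_{n,k} ∩ Γ) > 0, there exists l ∈ {−1,0,1}² such that ℋ¹(□_{n,k+l} ∩ Γ) ≥ 2^{-n}/9. -/

import Mathlib

open MeasureTheory
open scoped ENNReal

noncomputable def IsSimpleCurveUnion (Γ : Set (EuclideanSpace ℝ (Fin 2))) : Prop :=
  ∃ (K : ℕ) (γ : Fin K → ℝ → EuclideanSpace ℝ (Fin 2)) (b : Fin K → ℝ),
    (∀ i, 0 < b i) ∧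
    (∀ i, ContDiff ℝ 1 (γ i)) ∧
    (∀ i t, ‖deriv (γ i) t‖ = 1) ∧
    (∀ i, Set.InjOn (γ i) (Set.Icc 0 (b i))) ∧
    (∀ i j, i ≠ j →
      Disjoint (γ i '' Set.Icc 0 (b i)) (γ j '' Set.Icc 0 (b j))) ∧
    Γ = ⋃ i, γ i '' Set.Icc 0 (b i)

/-- The dyadic square `□_{n,k} = {2^{-n}(k + y) : y ∈ [0,1]²}`. -/
def dyadicSquare (n : ℕ) (k : Fin 2 → ℤ) : Set (EuclideanSpace ℝ (Fin 2)) :=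
  {x | ∀ i : Fin 2,
    (2 : ℝ) ^ (-(n : ℤ)) * (k i : ℝ) ≤ x i ∧ x i ≤ (2 : ℝ) ^ (-(n : ℤ)) * ((k i : ℝ) + 1)}

lemma aux_chord {E : Type*} [MetricSpace E] [MeasurableSpace E] [BorelSpace E]
    (f : ℝ → E) (hf : Continuous f) (a c : ℝ) (h : a ≤ c) :
    ENNReal.ofReal (dist (f c) (f a)) ≤ μH[1] (f '' Set.Icc a c) := by
  have hg : LipschitzWith 1 (fun x : E => dist x (f a)) := LipschitzWith.dist_left _
  have h1 := hg.hausdorffMeasure_image_le (d := 1) zero_le_one (f '' Set.Icc a c)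
  have h2 : Set.Icc 0 (dist (f c) (f a)) ⊆ (fun x : E => dist x (f a)) '' (f '' Set.Icc a c) := by
    rw [Set.image_image]
    have := intermediate_value_Icc (f := fun t => dist (f t) (f a)) h (by fun_prop)
    simpa using this
  have h3 := measure_mono (μ := (μH[1] : Measure ℝ)) h2
  have h4 : (μH[1] : Measure ℝ) (Set.Icc 0 (dist (f c) (f a)))
      = ENNReal.ofReal (dist (f c) (f a)) := by
    rw [hausdorffMeasure_real]; simp
  rw [h4] at h3
  refine h3.trans (h1.trans ?_)
  simp

lemma aux_lip {E : Type*} [NormedAddCommGroup E] [NormedSpace ℝ E]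
    (f : ℝ → E) (hf : ContDiff ℝ 1 f) (h1 : ∀ t, ‖deriv f t‖ = 1) (s t : ℝ) :
    ‖f s - f t‖ ≤ |s - t| := by
  have := Convex.norm_image_sub_le_of_norm_deriv_le (f := f) (C := 1) (s := Set.univ)
    (fun x _ => (hf.differentiable one_ne_zero) x) (fun x _ => (h1 x).le) convex_univ
    (Set.mem_univ t) (Set.mem_univ s)
  simpa using this

lemma aux_lower {E : Type*} [NormedAddCommGroup E] [NormedSpace ℝ E]
    (f : ℝ → E) (hf : ContDiff ℝ 1 f) (h1 : ∀ t, ‖deriv f t‖ = 1) (b : ℝ) :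
    ∃ r > 0, ∀ s ∈ Set.Icc 0 b, ∀ t ∈ Set.Icc 0 b, |s - t| < r →
      8 / 9 * |s - t| ≤ ‖f s - f t‖ := by
  have hd : Continuous (deriv f) := hf.continuous_deriv le_rfl
  have huc := isCompact_Icc.uniformContinuousOn_of_continuous
    (hd.continuousOn (s := Set.Icc 0 b))
  rw [Metric.uniformContinuousOn_iff] at huc
  obtain ⟨r, hr, H⟩ := huc (1 / 9) (by norm_num)
  refine ⟨r, hr, fun s hs t ht hst => ?_⟩
  have hD := hf.differentiable one_ne_zero
  have hder : ∀ x, HasDerivAt (fun u => f u - u • deriv f t) (deriv f x - deriv f t) x := by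
    intro x
    have := (hD x).hasDerivAt.sub ((hasDerivAt_id x).smul_const (deriv f t))
    simpa [Pi.sub_def] using this
  have key := Convex.norm_image_sub_le_of_norm_hasDerivWithin_le (C := 1 / 9)
    (s := Set.uIcc t s)
    (fun x _ => (hder x).hasDerivWithinAt) (fun x hx => ?_) (convex_uIcc t s)
    Set.left_mem_uIcc Set.right_mem_uIcc
  · have e : f s - f t = (f s - s • deriv f t - (f t - t • deriv f t)) + (s - t) • deriv f t := by
      rw [sub_smul]; abel
    have h2 : ‖(s - t) • deriv f t‖ = |s - t| := by rw [norm_smul, h1, mul_one, Real.norm_eq_abs]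
    have h3 : ‖(s - t) • deriv f t‖ ≤ ‖f s - f t‖ +
        ‖f s - s • deriv f t - (f t - t • deriv f t)‖ := by
      have : (s - t) • deriv f t = (f s - f t) - (f s - s • deriv f t - (f t - t • deriv f t)) := by
        rw [sub_smul]; abel
      rw [this]; exact norm_sub_le _ _
    rw [h2] at h3
    rw [Real.norm_eq_abs] at key
    linarith
  · have hx' : x ∈ Set.Icc 0 b := Set.uIcc_subset_Icc ht hs hx
    have hxt : |x - t| ≤ |s - t| := Set.abs_sub_left_of_mem_uIcc hx
    have := H x hx' t ht (by rw [Real.dist_eq]; linarith)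
    rw [dist_eq_norm] at this
    exact this.le

lemma aux_cover (n : ℕ) (k : Fin 2 → ℤ) (x : EuclideanSpace ℝ (Fin 2))
    (hx : x ∈ dyadicSquare n k) :
    ∃ m : Fin 2 → ℤ, (∀ i, m i = -1 ∨ m i = 0) ∧ ∀ y : EuclideanSpace ℝ (Fin 2),
      ‖y - x‖ ≤ (2 : ℝ) ^ (-(n : ℤ)) / 2 →
      ∃ e : Fin 2 → Fin 2, y ∈ dyadicSquare n (k + fun i => m i + ((e i : ℕ) : ℤ)) := by
  have hδ : (0:ℝ) < (2 : ℝ) ^ (-(n : ℤ)) := by positivity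
  simp only [dyadicSquare, Set.mem_ofPred_eq] at hx ⊢
  set δ := (2 : ℝ) ^ (-(n : ℤ))
  refine ⟨fun i => if x i ≤ δ * (k i + 1 / 2) then -1 else 0, fun i => by dsimp only; split_ifs <;> simp,
    fun y hy => ?_⟩
  refine ⟨fun i => if y i ≤ δ * (k i + (if x i ≤ δ * (k i + 1 / 2) then -1 else 0) + 1)
    then 0 else 1, fun i => ?_⟩
  have hc : |y i - x i| ≤ δ / 2 := by
    have := PiLp.norm_apply_le (y - x) i
    simp only [PiLp.sub_apply, Real.norm_eq_abs] at this
    linarith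
  have hxi := hx i
  rw [abs_le] at hc
  simp only [Pi.add_apply]
  split_ifs at * <;> simp <;> constructor <;> nlinarith

/-- for a simple union of `C¹` curve segments `Γ`, there is `N` such
that for all `n ≥ N` and all `k ∈ ℤ²` with `ℋ¹(□_{n,k} ∩ Γ) > 0`, there is an offset
`l ∈ {−1,0,1}²` with `ℋ¹(□_{n,k+l} ∩ Γ) ≥ 2^{−n}/9`. -/
theorem stmt1 (Γ : Set (EuclideanSpace ℝ (Fin 2))) (hΓ : IsSimpleCurveUnion Γ) :
    ∃ N : ℕ, ∀ n : ℕ, N ≤ n → ∀ k : Fin 2 → ℤ,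
      0 < μH[1] (dyadicSquare n k ∩ Γ) →
      ∃ l : Fin 2 → ℤ, (∀ i, l i ∈ ({-1, 0, 1} : Set ℤ)) ∧
        ENNReal.ofReal ((2 : ℝ) ^ (-(n : ℤ)) / 9) ≤ μH[1] (dyadicSquare n (k + l) ∩ Γ) := by
  obtain ⟨K, γ, b, hb, hC, h1, -, -, rfl⟩ := hΓ
  choose r hr hlow using fun i => aux_lower (γ i) (hC i) (h1 i) (b i)
  have hlim : Filter.Tendsto (fun n : ℕ => (2 : ℝ) ^ (-(n : ℤ))) Filter.atTop (nhds 0) := by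
    have := tendsto_pow_atTop_nhds_zero_of_lt_one (r := (1/2 : ℝ)) (by norm_num) (by norm_num)
    refine this.congr fun n => ?_
    simp
  have hev : ∀ᶠ n : ℕ in Filter.atTop, ∀ i, (2 : ℝ) ^ (-(n : ℤ)) < min (r i) (b i) :=
    Filter.eventually_all.2 fun i => hlim.eventually (gt_mem_nhds (lt_min (hr i) (hb i)))
  obtain ⟨N, hN⟩ := Filter.eventually_atTop.1 hev
  refine ⟨N, fun n hn k hk => ?_⟩
  obtain ⟨x, hx, hxΓ⟩ : (dyadicSquare n k ∩ ⋃ i, γ i '' Set.Icc 0 (b i)).Nonempty :=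
    nonempty_of_measure_ne_zero hk.ne'
  obtain ⟨i, t, ht, rfl⟩ := Set.mem_iUnion.1 hxΓ
  have hni := lt_min_iff.1 (hN n hn i)
  obtain ⟨m, hm, hcov⟩ := aux_cover n k _ hx
  have hδ : (0:ℝ) < (2 : ℝ) ^ (-(n : ℤ)) := by positivity
  generalize hδe : (2 : ℝ) ^ (-(n : ℤ)) = δ at *
  obtain ⟨a, ha0, hab, hat, hta⟩ : ∃ a, 0 ≤ a ∧ a + δ / 2 ≤ b i ∧ a ≤ t ∧ t ≤ a + δ / 2 := by
    by_cases h : t + δ / 2 ≤ b i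
    · exact ⟨t, ht.1, h, le_rfl, by linarith⟩
    · exact ⟨t - δ / 2, by linarith, by linarith [ht.2], by linarith, by linarith⟩
  have hlen : ENNReal.ofReal (4 * (δ / 9)) ≤ μH[1] (γ i '' Set.Icc a (a + δ / 2)) := by
    refine le_trans (ENNReal.ofReal_le_ofReal ?_)
      (aux_chord (γ i) (hC i).continuous a (a + δ / 2) (by linarith))
    have habs : |a + δ / 2 - a| = δ / 2 := by rw [add_sub_cancel_left, abs_of_pos (by linarith)]
    have := hlow i (a + δ / 2) ⟨by linarith, hab⟩ a ⟨ha0, by linarith⟩ (by rw [habs]; linarith)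
    rw [habs] at this
    rw [dist_eq_norm]
    linarith
  by_contra! hcon
  have hsub : γ i '' Set.Icc a (a + δ / 2) ⊆ ⋃ e : Fin 2 → Fin 2,
      (dyadicSquare n (k + fun i => m i + ((e i : ℕ) : ℤ)) ∩ ⋃ i, γ i '' Set.Icc 0 (b i)) := by
    rintro _ ⟨s, hs, rfl⟩
    obtain ⟨e, he⟩ := hcov (γ i s) ((aux_lip _ (hC i) (h1 i) s t).trans
      (abs_le.2 ⟨by linarith [hs.1], by linarith [hs.2]⟩))
    exact Set.mem_iUnion.2 ⟨e, he, Set.mem_iUnion.2 ⟨i, s, ⟨by linarith [hs.1],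
      by linarith [hs.2]⟩, rfl⟩⟩
  have hle := hlen.trans ((measure_mono hsub).trans (measure_iUnion_fintype_le _ _))
  have hlt : ∑ e : Fin 2 → Fin 2, μH[1] (dyadicSquare n (k + fun i => m i + ((e i : ℕ) : ℤ)) ∩
      ⋃ i, γ i '' Set.Icc 0 (b i)) < ∑ e : Fin 2 → Fin 2, ENNReal.ofReal (δ / 9) := by
    refine ENNReal.sum_lt_sum_of_nonempty Finset.univ_nonempty fun e _ => hcon _ fun j => ?_
    have := (e j).isLt
    rcases hm j with h | h <;> simp [h] <;> omega
  have hsum : ∑ e : Fin 2 → Fin 2, ENNReal.ofReal (δ / 9) = ENNReal.ofReal (4 * (δ / 9)) := by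
    rw [ENNReal.ofReal_mul (by norm_num)]
    simp
  rw [hsum] at hlt
  exact absurd hle (not_le.2 hlt)
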